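/- Assume the dilations are isotropic, a_j = α_j I with α_j real nonzero, and assume the analyzer φ is a Schwartz function with φ̂ supported in C₀ b^{-1}. Fix j > 0, choose ν as in the definition of the discrete Riesz kernel z, and let μ_j be the Schwartz function with μ̂_j(ξ) = ν(ξ a_j^{-1} b). If f ∈ H¹(ℝ^d) then z * (T_j f) = sign(α_j) · T_j ( R(μ_j * f) ), where the convolution on the left is in the k-index and R denotes the (continuous) Riesz transform. That is, the discrete Riesz transform of the analyzed sequence equals (up to sign(α_j)) the analysis of the Riesz transform of the mollified function. -/

import Mathlib

open MeasureTheory Filter Matrix Set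
open scoped ENNReal NNReal Topology

noncomputable section

namespace AffinePaper

/-- Embed an integer lattice point `k ∈ ℤ^d` into `ℝ^d`. -/
def intVec {d : ℕ} (k : Fin d → ℤ) : Fin d → ℝ := fun i => (k i : ℝ)

/-- Euclidean norm `|x|` on `ℝ^d`. -/
def eucNorm {d : ℕ} (x : Fin d → ℝ) : ℝ := Real.sqrt (∑ i, x i ^ 2)

/-- The constant `C_d = Γ((d+1)/2) π^{-(d+1)/2}` of the Riesz kernel. -/
def rieszConst (d : ℕ) : ℝ :=
  Real.Gamma (((d : ℝ) + 1) / 2) / Real.pi ^ (((d : ℝ) + 1) / 2)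

/-- The (vector-valued) Riesz kernel `Z(x) = C_d x / |x|^{d+1}`, with `Z(0) = 0`. -/
def rieszKernel (d : ℕ) (x : Fin d → ℝ) : Fin d → ℝ :=
  if x = 0 then 0 else fun i => rieszConst d * x i / eucNorm x ^ (d + 1)

/-- The truncated singular integral `∫_{|y| > ε} f(x-y) Z(y) dy` (vector-valued). -/
def truncRiesz {d : ℕ} (f : (Fin d → ℝ) → ℂ) (x : Fin d → ℝ) (ε : ℝ) : Fin d → ℂ :=
  ∫ y in {y : Fin d → ℝ | ε < eucNorm y}, (fun i => f (x - y) * ((rieszKernel d y i : ℝ) : ℂ))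

/-- `g` is the Riesz transform `Rf = f * Z` of `f`, in the principal value sense:
for a.e. `x` the truncated integrals converge to `g(x)` as `ε → 0+`. -/
def HasRiesz {d : ℕ} (f : (Fin d → ℝ) → ℂ) (g : (Fin d → ℝ) → Fin d → ℂ) : Prop :=
  ∀ᵐ x : Fin d → ℝ, Tendsto (fun ε : ℝ => truncRiesz f x ε) (𝓝[>] 0) (𝓝 (g x))

/-- Membership in the Hardy space `H¹(ℝ^d) = { f ∈ L¹ : Rf ∈ L¹ }`. -/
def MemH1 {d : ℕ} (f : (Fin d → ℝ) → ℂ) : Prop :=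
  Integrable f volume ∧ ∃ g : (Fin d → ℝ) → Fin d → ℂ, Integrable g volume ∧ HasRiesz f g

/-- The Hardy norm `‖f‖_{H¹} = ‖f‖₁ + ‖Rf‖₁`, as a value in `[0,∞]` (equal to `∞` when
`f` admits no integrable Riesz transform; the Riesz transform is a.e. unique, so the
infimum below is over a set of at most one value). -/
def hardyNorm {d : ℕ} (f : (Fin d → ℝ) → ℂ) : ℝ≥0∞ :=
  ENNReal.ofReal (∫ x : Fin d → ℝ, ‖f x‖) +
    sInf {r : ℝ≥0∞ | ∃ g : (Fin d → ℝ) → Fin d → ℂ,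
      Integrable g volume ∧ HasRiesz f g ∧ r = ENNReal.ofReal (∫ x : Fin d → ℝ, ‖g x‖)}

/-- The centered open unit cube `C₀ = (-1/2, 1/2)^d`. -/
def centeredCube (d : ℕ) : Set (Fin d → ℝ) :=
  Set.univ.pi fun _ => Set.Ioo (-(1/2) : ℝ) (1/2)

/-- `ν` is a smooth cut-off function: supported in the centered unit cube `C₀` and
identically `1` near the origin. -/
structure IsCutoff (d : ℕ) (ν : (Fin d → ℝ) → ℝ) : Prop where
  smooth : ContDiff ℝ (⊤ : ℕ∞) ν
  supp : tsupport ν ⊆ centeredCube d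
  one_near_zero : ∀ᶠ ξ in 𝓝 0, ν ξ = 1

/-- The periodic function `ζ(ξ) = -i (ξ b⁻¹ / |ξ b⁻¹|) ν(ξ)` (vector-valued), whose Fourier
coefficients define the discrete Riesz kernel. -/
def zetaFn {d : ℕ} (b : Matrix (Fin d) (Fin d) ℝ) (ν : (Fin d → ℝ) → ℝ)
    (ξ : Fin d → ℝ) : Fin d → ℂ :=
  fun i => -Complex.I * ((((ξ ᵥ* b⁻¹) i / eucNorm (ξ ᵥ* b⁻¹) : ℝ)) : ℂ) * ((ν ξ : ℝ) : ℂ)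

/-- The discrete Riesz kernel `z = {z_k}`, defined through its Fourier series
`Σ_k z_k e^{-2πi ξ k} = ζ(ξ)`, `ξ ∈ C₀`; that is, `z_k = ∫_{C₀} ζ(ξ) e^{2πi ξ k} dξ`. -/
def zKernel {d : ℕ} (b : Matrix (Fin d) (Fin d) ℝ) (ν : (Fin d → ℝ) → ℝ)
    (k : Fin d → ℤ) : Fin d → ℂ :=
  ∫ ξ in centeredCube d,
    Complex.exp (((2 * Real.pi * ∑ i, ξ i * (k i : ℝ) : ℝ)) * Complex.I) • zetaFn b ν ξ

/-- Discrete convolution `(s * z)_k = Σ_l s_{k-l} z_l` of a scalar sequence with the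
(vector-valued) kernel `z`, in the `k`-index. -/
def dConv {d : ℕ} (s : (Fin d → ℤ) → ℂ) (z : (Fin d → ℤ) → Fin d → ℂ)
    (k : Fin d → ℤ) : Fin d → ℂ :=
  ∑' l : Fin d → ℤ, s (k - l) • z l

/-- The discrete Hardy norm `‖s‖_{h¹} = ‖s‖_{ℓ¹} + ‖s * z‖_{ℓ¹}` (value in `[0,∞]`). -/
def h1Norm {d : ℕ} (b : Matrix (Fin d) (Fin d) ℝ) (ν : (Fin d → ℝ) → ℝ)
    (s : (Fin d → ℤ) → ℂ) : ℝ≥0∞ :=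
  (∑' k : Fin d → ℤ, (‖s k‖₊ : ℝ≥0∞)) +
    ∑' k : Fin d → ℤ, (‖dConv s (zKernel b ν) k‖₊ : ℝ≥0∞)

/-- The mixed norm `‖c‖_{ℓ¹(h¹)} = Σ_j ‖c_j‖_{h¹}` (value in `[0,∞]`). -/
def l1h1Norm {d : ℕ} (b : Matrix (Fin d) (Fin d) ℝ) (ν : (Fin d → ℝ) → ℝ)
    (c : ℕ → (Fin d → ℤ) → ℂ) : ℝ≥0∞ :=
  ∑' j : ℕ, h1Norm b ν (c j)

/-- `ψ_{j,k}(x) = |det a_j| ψ(a_j x - bk)` for isotropic dilations `a_j = α_j I`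
(Hardy-space normalization, `p = 1`). -/
def rescH {d : ℕ} (α : ℕ → ℝ) (b : Matrix (Fin d) (Fin d) ℝ) (ψ : (Fin d → ℝ) → ℂ)
    (j : ℕ) (k : Fin d → ℤ) (x : Fin d → ℝ) : ℂ :=
  ((|α j| ^ d : ℝ) : ℂ) * ψ (α j • x - b *ᵥ intVec k)

/-- The synthesis series `Sc = Σ_j Σ_k c_{j,k} ψ_{j,k}` converges to `f` in `H¹`:
for each `j` the sum over `k` converges absolutely in `L¹` to a function belonging to
`H¹`, and the sum over `j` converges absolutely in `H¹`, with limit `f`. -/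
def H1SynthesisTo {d : ℕ} (α : ℕ → ℝ) (b : Matrix (Fin d) (Fin d) ℝ)
    (ψ : (Fin d → ℝ) → ℂ) (c : ℕ → (Fin d → ℤ) → ℂ) (f : (Fin d → ℝ) → ℂ) : Prop :=
  (∀ j : ℕ, Summable fun k : Fin d → ℤ => ∫ x : Fin d → ℝ, ‖c j k * rescH α b ψ j k x‖) ∧
  (∀ j : ℕ, MemH1 (fun x => ∑' k : Fin d → ℤ, c j k * rescH α b ψ j k x)) ∧
  Summable (fun j : ℕ =>
    (hardyNorm (fun x => ∑' k : Fin d → ℤ, c j k * rescH α b ψ j k x)).toReal) ∧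
  Tendsto (fun J : ℕ => hardyNorm
      (fun x => f x - ∑ j ∈ Finset.range J, ∑' k : Fin d → ℤ, c j k * rescH α b ψ j k x))
    atTop (𝓝 0)

/-- Analysis operator at scale `j` in the Hardy-space setting (`p = 1`, `q = ∞`):
`(T_j f)_k = |det b| ⟨f, φ_{j,k}⟩` with `φ_{j,k}(x) = φ(α_j x - bk)`. -/
def TjH {d : ℕ} (α : ℕ → ℝ) (b : Matrix (Fin d) (Fin d) ℝ) (φ : (Fin d → ℝ) → ℂ)
    (f : (Fin d → ℝ) → ℂ) (j : ℕ) (k : Fin d → ℤ) : ℂ :=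
  ((|b.det| : ℝ) : ℂ) *
    ∫ x : Fin d → ℝ, f x * (starRingEnd ℂ) (φ (α j • x - b *ᵥ intVec k))

/-- Dot product of row vector `ξ` and column vector `x`. -/
def dotP {d : ℕ} (ξ x : Fin d → ℝ) : ℝ := ∑ i, ξ i * x i

/-- Fourier transform `f̂(ξ) = ∫ f(x) e^{-2πi ξ x} dx`. -/
def ft {d : ℕ} (f : (Fin d → ℝ) → ℂ) (ξ : Fin d → ℝ) : ℂ :=
  ∫ x : Fin d → ℝ, Complex.exp ((-(2 * Real.pi * dotP ξ x) : ℝ) * Complex.I) * f x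

/-- Inverse Fourier transform `ǧ(x) = ∫ g(ξ) e^{2πi ξ x} dξ`. -/
def ftInv {d : ℕ} (g : (Fin d → ℝ) → ℂ) (x : Fin d → ℝ) : ℂ :=
  ∫ ξ : Fin d → ℝ, Complex.exp (((2 * Real.pi * dotP ξ x) : ℝ) * Complex.I) * g ξ

/-- `f` is a Schwartz function. -/
def IsSchwartz {d : ℕ} (f : (Fin d → ℝ) → ℂ) : Prop :=
  ∃ Φ : SchwartzMap (Fin d → ℝ) ℂ, ∀ x, f x = Φ x

/-- Convolution `(f * g)(x) = ∫ f(y) g(x - y) dy`. -/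
def conv {d : ℕ} (f g : (Fin d → ℝ) → ℂ) (x : Fin d → ℝ) : ℂ :=
  ∫ y : Fin d → ℝ, f y * g (x - y)

/-- The periodization `Pg(x) = |det b| Σ_{k ∈ ℤ^d} g(x - bk)` of a real-valued function. -/
def periodization {d : ℕ} (b : Matrix (Fin d) (Fin d) ℝ) (g : (Fin d → ℝ) → ℝ)
    (x : Fin d → ℝ) : ℝ :=
  |b.det| * ∑' k : Fin d → ℤ, g (x - b *ᵥ intVec k)

/-- The character `x ↦ e^{2πi ξ x}`. -/
def chr {d : ℕ} (ξ x : Fin d → ℝ) : ℂ :=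
  Complex.exp (((2 * Real.pi * dotP ξ x) : ℝ) * Complex.I)

section Characters

variable {d : ℕ}

lemma norm_chr (ξ x : Fin d → ℝ) : ‖chr ξ x‖ = 1 := Complex.norm_exp_ofReal_mul_I _

lemma conj_chr (ξ x : Fin d → ℝ) : (starRingEnd ℂ) (chr ξ x) = chr ξ (-x) := by
  rw [chr, chr, ← Complex.exp_conj, map_mul, Complex.conj_ofReal, Complex.conj_I]
  simp [dotP]

lemma chr_add (ξ x y : Fin d → ℝ) : chr ξ (x + y) = chr ξ x * chr ξ y := by
  simp only [chr, ← Complex.exp_add, dotP, Pi.add_apply, mul_add, Finset.sum_add_distrib]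
  push_cast
  ring_nf

lemma chr_sub (ξ x y : Fin d → ℝ) : chr ξ (x - y) = chr ξ x * chr ξ (-y) := by
  rw [sub_eq_add_neg, chr_add]

lemma continuous_dotP : Continuous fun p : (Fin d → ℝ) × (Fin d → ℝ) => dotP p.1 p.2 := by
  unfold dotP; fun_prop

lemma continuous_chr : Continuous fun p : (Fin d → ℝ) × (Fin d → ℝ) => chr p.1 p.2 := by
  unfold chr; have := continuous_dotP (d := d); fun_prop

@[fun_prop]
lemma Continuous.chr {X : Type*} [TopologicalSpace X] {u v : X → Fin d → ℝ}
    (hu : Continuous u) (hv : Continuous v) : Continuous fun p => chr (u p) (v p) :=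
  continuous_chr.comp (hu.prodMk hv)

lemma ft_eq (f : (Fin d → ℝ) → ℂ) (ξ : Fin d → ℝ) : ft f ξ = ∫ x, chr ξ (-x) * f x := by
  simp [ft, chr, dotP]

lemma ftInv_eq (f : (Fin d → ℝ) → ℂ) (x : Fin d → ℝ) : ftInv f x = ∫ ξ, chr ξ x * f ξ := rfl

lemma integrable_chr_mul {f : (Fin d → ℝ) → ℂ} (hf : Integrable f) {u v : (Fin d → ℝ) → Fin d → ℝ}
    (hu : Continuous u) (hv : Continuous v) : Integrable fun x => chr (u x) (v x) * f x :=
  hf.bdd_mul (c := 1) (Continuous.chr hu hv).aestronglyMeasurable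
    (ae_of_all _ fun _ => (norm_chr _ _).le)

lemma norm_ft_le {f : (Fin d → ℝ) → ℂ} (ξ : Fin d → ℝ) : ‖ft f ξ‖ ≤ ∫ x, ‖f x‖ := by
  rw [ft_eq]
  refine (norm_integral_le_integral_norm _).trans_eq ?_
  simp [norm_chr]

lemma norm_ftInv_le {f : (Fin d → ℝ) → ℂ} (ξ : Fin d → ℝ) : ‖ftInv f ξ‖ ≤ ∫ x, ‖f x‖ := by
  rw [ftInv_eq]
  refine (norm_integral_le_integral_norm _).trans_eq ?_
  simp [norm_chr]

lemma continuous_ft {f : (Fin d → ℝ) → ℂ} (hf : Integrable f) : Continuous (ft f) := by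
  simp only [funext (ft_eq f)]
  refine continuous_of_dominated (bound := fun x => ‖f x‖) (fun ξ => ?_) (fun ξ => ?_) hf.norm ?_
  · exact (integrable_chr_mul hf continuous_const continuous_neg).aestronglyMeasurable
  · exact ae_of_all _ fun x => by simp [norm_chr]
  · exact ae_of_all _ fun x => by fun_prop

lemma continuous_ftInv {f : (Fin d → ℝ) → ℂ} (hf : Integrable f) : Continuous (ftInv f) := by
  simp only [funext (ftInv_eq f)]
  refine continuous_of_dominated (bound := fun x => ‖f x‖) (fun ξ => ?_) (fun ξ => ?_) hf.norm ?_
  · exact (integrable_chr_mul hf continuous_id continuous_const).aestronglyMeasurable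
  · exact ae_of_all _ fun x => by simp [norm_chr]
  · exact ae_of_all _ fun x => by fun_prop

end Characters

section Gaussian

lemma integral_gaussian_mul_exp {t : ℝ} (ht : 0 < t) (s : ℝ) :
    ∫ x : ℝ, Complex.exp (-((Real.pi * t : ℝ) : ℂ) * (x : ℂ) ^ 2
      + (-(2 * Real.pi * s * Complex.I)) * x + 0) =
      ((t ^ (-(1 / 2) : ℝ) * Real.exp (-(Real.pi * s ^ 2 / t)) : ℝ) : ℂ) := by
  have hpi := Real.pi_pos
  have hb : ((-((Real.pi * t : ℝ) : ℂ))).re < 0 := by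
    simp only [Complex.neg_re, Complex.ofReal_re]; have := mul_pos hpi ht; linarith
  rw [integral_cexp_quadratic hb]
  have htc : (t : ℂ) ≠ 0 := by exact_mod_cast ht.ne'
  have hpc : (Real.pi : ℂ) ≠ 0 := by exact_mod_cast hpi.ne'
  have h1 : (Real.pi : ℂ) / - -((Real.pi * t : ℝ) : ℂ) = ((t⁻¹ : ℝ) : ℂ) := by
    push_cast; field_simp
  have h2 : (0 : ℂ) - (-(2 * Real.pi * s * Complex.I)) ^ 2 / (4 * -((Real.pi * t : ℝ) : ℂ))
      = ((-(Real.pi * s ^ 2 / t) : ℝ) : ℂ) := by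
    push_cast; field_simp; ring_nf; simp
  rw [h1, h2, ← Complex.ofReal_exp, Complex.ofReal_mul, Real.rpow_neg ht.le, ← Real.inv_rpow ht.le,
    Complex.ofReal_cpow (inv_pos.2 ht).le]
  push_cast
  rfl

lemma integrable_mul_gaussian {t : ℝ} (ht : 0 < t) (s : ℝ) :
    Integrable fun x : ℝ => (x : ℂ) * Complex.exp (-((Real.pi * t : ℝ) : ℂ) * (x : ℂ) ^ 2
      + (-(2 * Real.pi * s * Complex.I)) * x + 0) := by
  have h := (integrable_mul_exp_neg_mul_sq (mul_pos Real.pi_pos ht)).norm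
  refine Integrable.mono' h (by fun_prop) (ae_of_all _ fun x => ?_)
  rw [norm_mul, norm_mul, Complex.norm_exp]
  simp [pow_two]

lemma integral_mul_gaussian_mul_exp {t : ℝ} (ht : 0 < t) (s : ℝ) :
    ∫ x : ℝ, (x : ℂ) * Complex.exp (-((Real.pi * t : ℝ) : ℂ) * (x : ℂ) ^ 2
      + (-(2 * Real.pi * s * Complex.I)) * x + 0) =
      (-Complex.I * (s / t)) * ((t ^ (-(1 / 2) : ℝ) * Real.exp (-(Real.pi * s ^ 2 / t)) : ℝ) : ℂ) := by
  have hpi := Real.pi_pos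
  have htc : (t : ℂ) ≠ 0 := by exact_mod_cast ht.ne'
  have hpc : (Real.pi : ℂ) ≠ 0 := by exact_mod_cast hpi.ne'
  set E : ℝ → ℂ := fun x => Complex.exp (-((Real.pi * t : ℝ) : ℂ) * (x : ℂ) ^ 2
      + (-(2 * Real.pi * s * Complex.I)) * x + 0) with hE
  have hI1 : Integrable fun x : ℝ => (x : ℂ) * E x := integrable_mul_gaussian ht s
  have hI0 : Integrable E := by
    apply integrable_cexp_quadratic
    simpa using mul_pos hpi ht
  have hderiv : ∀ x : ℝ, HasDerivAt E
      (-(2 * Real.pi * t : ℂ) * (x * E x) + (-(2 * Real.pi * s * Complex.I)) * E x) x := by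
    intro x
    have hx : HasDerivAt (fun x : ℝ => (x : ℂ)) 1 x := Complex.ofRealCLM.hasDerivAt
    have := ((((hx.pow 2).const_mul (-((Real.pi * t : ℝ) : ℂ))).add
      (hx.const_mul (-(2 * Real.pi * s * Complex.I)))).add_const 0).cexp
    refine this.congr_deriv ?_
    simp only [hE]
    push_cast
    simp only [Pi.pow_apply, Pi.add_apply]
    ring
  have h0 := integral_eq_zero_of_hasDerivAt_of_integrable hderiv
    ((hI1.const_mul _).add (hI0.const_mul _)) hI0
  rw [integral_add (hI1.const_mul _) (hI0.const_mul _), integral_const_mul, integral_const_mul,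
    integral_gaussian_mul_exp ht s] at h0
  have h2 : (2 * Real.pi * t : ℂ) ≠ 0 := by simp [htc, hpc]
  have h3 : (t : ℂ) * (s / t) = s := mul_div_cancel₀ _ htc
  apply mul_left_cancel₀ h2
  change (2 * Real.pi * t : ℂ) * (∫ x : ℝ, (x : ℂ) * E x) = _
  linear_combination (-1 : ℂ) * h0 + 2 * Real.pi * Complex.I *
    ((t ^ (-(1 / 2) : ℝ) * Real.exp (-(Real.pi * s ^ 2 / t)) : ℝ) : ℂ) * h3

variable {d : ℕ}

lemma eucNorm_sq (x : Fin d → ℝ) : eucNorm x ^ 2 = ∑ i, x i ^ 2 :=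
  Real.sq_sqrt (Finset.sum_nonneg fun _ _ => sq_nonneg _)

lemma eucNorm_nonneg (x : Fin d → ℝ) : 0 ≤ eucNorm x := Real.sqrt_nonneg _

lemma continuous_eucNorm : Continuous (eucNorm (d := d)) := by
  unfold eucNorm; fun_prop

lemma abs_le_eucNorm (x : Fin d → ℝ) (i : Fin d) : |x i| ≤ eucNorm x := by
  apply Real.abs_le_sqrt
  exact Finset.single_le_sum (f := fun i => x i ^ 2) (fun _ _ => sq_nonneg _) (Finset.mem_univ i)

lemma norm_le_eucNorm (x : Fin d → ℝ) : ‖x‖ ≤ eucNorm x :=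
  (pi_norm_le_iff_of_nonneg (eucNorm_nonneg x)).2 fun i => abs_le_eucNorm x i

lemma eucNorm_pos {x : Fin d → ℝ} (hx : x ≠ 0) : 0 < eucNorm x :=
  (norm_pos_iff.2 hx).trans_le (norm_le_eucNorm x)

lemma eucNorm_neg (x : Fin d → ℝ) : eucNorm (-x) = eucNorm x := by simp [eucNorm]

lemma chr_mul_gaussian_eq_prod (t : ℝ) (ξ y : Fin d → ℝ) (i : Fin d) :
    chr ξ (-y) * ((y i * Real.exp (-(Real.pi * t * eucNorm y ^ 2)) : ℝ) : ℂ) =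
      ∏ k, (if k = i then (y k : ℂ) else 1) * Complex.exp (-((Real.pi * t : ℝ) : ℂ) * (y k : ℂ) ^ 2
      + (-(2 * Real.pi * ξ k * Complex.I)) * y k + 0) := by
  rw [Finset.prod_mul_distrib, Finset.prod_ite_eq' Finset.univ i, ← Complex.exp_sum, eucNorm_sq]
  simp only [Finset.mem_univ, if_true, chr, dotP]
  push_cast
  rw [mul_left_comm, ← Complex.exp_add]
  congr 2
  simp only [add_zero, Finset.sum_add_distrib, Pi.neg_apply, Complex.ofReal_neg, mul_neg,
    Finset.sum_neg_distrib, neg_mul, Finset.mul_sum, Finset.sum_mul]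
  rw [add_comm]
  congr 2
  exact Finset.sum_congr rfl fun _ _ => by ring

lemma integrable_chr_mul_gaussian {t : ℝ} (ht : 0 < t) (ξ : Fin d → ℝ) (i : Fin d) :
    Integrable fun y : Fin d → ℝ =>
      chr ξ (-y) * ((y i * Real.exp (-(Real.pi * t * eucNorm y ^ 2)) : ℝ) : ℂ) := by
  simp only [chr_mul_gaussian_eq_prod]
  refine Integrable.fintype_prod (f := fun k (v : ℝ) => (if k = i then (v : ℂ) else 1) *
    Complex.exp (-((Real.pi * t : ℝ) : ℂ) * (v : ℂ) ^ 2
      + (-(2 * Real.pi * ξ k * Complex.I)) * v + 0)) fun k => ?_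
  by_cases hk : k = i
  · simp only [hk, if_true]
    exact integrable_mul_gaussian ht _
  · simp only [hk, if_false, one_mul]
    apply integrable_cexp_quadratic
    simpa using mul_pos Real.pi_pos ht

lemma integral_chr_mul_gaussian {t : ℝ} (ht : 0 < t) (ξ : Fin d → ℝ) (i : Fin d) :
    ∫ y : Fin d → ℝ, chr ξ (-y) * ((y i * Real.exp (-(Real.pi * t * eucNorm y ^ 2)) : ℝ) : ℂ) =
      -Complex.I * ((ξ i * (t ^ (-1 - d / 2 : ℝ) *
        Real.exp (-(Real.pi * eucNorm ξ ^ 2 / t))) : ℝ) : ℂ) := by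
  simp only [chr_mul_gaussian_eq_prod]
  rw [integral_fintype_prod_volume_eq_prod (f := fun k (v : ℝ) => (if k = i then (v : ℂ) else 1) *
    Complex.exp (-((Real.pi * t : ℝ) : ℂ) * (v : ℂ) ^ 2
      + (-(2 * Real.pi * ξ k * Complex.I)) * v + 0))]
  have h1 : ∀ k, ∫ v : ℝ, (if k = i then (v : ℂ) else 1) *
      Complex.exp (-((Real.pi * t : ℝ) : ℂ) * (v : ℂ) ^ 2
      + (-(2 * Real.pi * ξ k * Complex.I)) * v + 0) =
      (if k = i then (-Complex.I * (ξ k / t)) else 1) *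
        ((t ^ (-(1 / 2) : ℝ) * Real.exp (-(Real.pi * ξ k ^ 2 / t)) : ℝ) : ℂ) := by
    intro k
    by_cases hk : k = i
    · simp only [hk, if_true]
      exact integral_mul_gaussian_mul_exp ht _
    · simp only [hk, if_false, one_mul]
      exact integral_gaussian_mul_exp ht _
  simp only [h1]
  rw [Finset.prod_mul_distrib, Finset.prod_ite_eq' Finset.univ i, ← Complex.ofReal_prod,
    Finset.prod_mul_distrib, Finset.prod_const, ← Real.exp_sum, eucNorm_sq]
  simp only [Finset.mem_univ, if_true, Finset.card_univ, Fintype.card_fin]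
  have h2 : t ^ (-1 - d / 2 : ℝ) = t⁻¹ * (t ^ (-(1 / 2) : ℝ)) ^ d := by
    rw [← Real.rpow_natCast, ← Real.rpow_mul ht.le, ← Real.rpow_neg_one t, ← Real.rpow_add ht]
    congr 1; ring
  have h3 : ∑ x, -(Real.pi * ξ x ^ 2 / t) = -(Real.pi * (∑ x, ξ x ^ 2) / t) := by
    rw [Finset.sum_neg_distrib, Finset.mul_sum, Finset.sum_div]
  rw [h2, h3]
  push_cast
  ring

end Gaussian

section KernelIntegrals

variable {d : ℕ}

lemma integrableOn_rpow_mul_exp_neg_mul {s r : ℝ} (hs : -1 < s) (hr : 0 < r) :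
    IntegrableOn (fun t : ℝ => t ^ s * Real.exp (-(r * t))) (Ioi 0) := by
  simpa using integrableOn_rpow_mul_exp_neg_mul_rpow hs zero_lt_one hr

lemma integrableOn_rieszKernel_repr (y : Fin d → ℝ) (i : Fin d) :
    IntegrableOn (fun t : ℝ => y i * Real.exp (-(Real.pi * t * eucNorm y ^ 2)) *
      t ^ (((d : ℝ) - 1) / 2)) (Ioi 0) := by
  by_cases hy : y = 0
  · simp [hy]
  have hr : 0 < Real.pi * eucNorm y ^ 2 := mul_pos Real.pi_pos (pow_pos (eucNorm_pos hy) 2)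
  have hs : (-1 : ℝ) < ((d : ℝ) - 1) / 2 := by have : (0 : ℝ) ≤ d := d.cast_nonneg; linarith
  refine ((integrableOn_rpow_mul_exp_neg_mul hs hr).const_mul (y i)).congr (ae_of_all _ fun t => ?_)
  simp only
  rw [mul_right_comm Real.pi t]
  ring

lemma integral_rieszKernel_repr (y : Fin d → ℝ) (i : Fin d) :
    ∫ t in Ioi (0 : ℝ), y i * Real.exp (-(Real.pi * t * eucNorm y ^ 2)) *
      t ^ (((d : ℝ) - 1) / 2) = rieszKernel d y i := by
  by_cases hy : y = 0
  · simp [hy, rieszKernel]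
  have hN := eucNorm_pos hy
  have hr : 0 < Real.pi * eucNorm y ^ 2 := mul_pos Real.pi_pos (pow_pos hN 2)
  have ha : (0 : ℝ) < ((d : ℝ) + 1) / 2 := by positivity
  have h := Real.integral_rpow_mul_exp_neg_mul_Ioi ha hr
  have h1 : (1 / (Real.pi * eucNorm y ^ 2)) ^ (((d : ℝ) + 1) / 2) =
      1 / (Real.pi ^ (((d : ℝ) + 1) / 2) * eucNorm y ^ (d + 1)) := by
    rw [Real.div_rpow zero_le_one hr.le, Real.one_rpow, Real.mul_rpow Real.pi_pos.le (by positivity),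
      ← Real.rpow_natCast (eucNorm y) 2, ← Real.rpow_mul hN.le, ← Real.rpow_natCast _ (d + 1)]
    congr 4
    push_cast; ring
  have h2 : ∀ t : ℝ, y i * Real.exp (-(Real.pi * t * eucNorm y ^ 2)) * t ^ (((d : ℝ) - 1) / 2) =
      y i * (t ^ (((d : ℝ) + 1) / 2 - 1) * Real.exp (-(Real.pi * eucNorm y ^ 2 * t))) := by
    intro t
    rw [mul_right_comm Real.pi t, show ((d : ℝ) + 1) / 2 - 1 = ((d : ℝ) - 1) / 2 by ring]
    ring
  simp only [h2, integral_const_mul, h, h1, rieszKernel, hy, if_false, rieszConst]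
  field_simp

/-- The profile in `t` arising from the Fourier transform of the heat-type kernels. -/
def heatProfile (d : ℕ) (N t : ℝ) : ℝ :=
  t ^ (((d : ℝ) - 1) / 2) * (t ^ (-1 - (d : ℝ) / 2) * Real.exp (-(Real.pi * N ^ 2 / t)))

lemma heatProfile_eq {N t : ℝ} (ht : 0 < t) : heatProfile d N t =
    (|(-1 : ℝ)| * t ^ ((-1 : ℝ) - 1)) • ((t ^ (-1 : ℝ)) ^ ((1 / 2 : ℝ) - 1) *
      Real.exp (-(Real.pi * N ^ 2 * t ^ (-1 : ℝ)))) := by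
  rw [heatProfile, ← mul_assoc, ← Real.rpow_add ht, ← Real.rpow_mul ht.le, abs_neg, abs_one, one_mul,
    smul_eq_mul, ← mul_assoc, ← Real.rpow_add ht, Real.rpow_neg_one, div_eq_mul_inv]
  congr 2
  ring

lemma heatProfile_nonneg {N t : ℝ} (ht : 0 < t) : 0 ≤ heatProfile d N t := by
  unfold heatProfile; positivity

lemma integrableOn_heatProfile {N : ℝ} (hN : 0 < N) : IntegrableOn (heatProfile d N) (Ioi 0) := by
  have hr : 0 < Real.pi * N ^ 2 := mul_pos Real.pi_pos (pow_pos hN 2)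
  refine ((integrableOn_Ioi_comp_rpow_iff _ (by norm_num : (-1 : ℝ) ≠ 0)).2
    (integrableOn_rpow_mul_exp_neg_mul (by norm_num : (-1 : ℝ) < (1 / 2 : ℝ) - 1) hr)).congr_fun
    (fun t ht => (heatProfile_eq ht).symm) measurableSet_Ioi

lemma integral_heatProfile {N : ℝ} (hN : 0 < N) : ∫ t in Ioi (0 : ℝ), heatProfile d N t = 1 / N := by
  have hr : 0 < Real.pi * N ^ 2 := mul_pos Real.pi_pos (pow_pos hN 2)
  rw [setIntegral_congr_fun measurableSet_Ioi (fun t ht => heatProfile_eq (d := d) (N := N) ht),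
    integral_comp_rpow_Ioi (fun s => s ^ ((1 / 2 : ℝ) - 1) * Real.exp (-(Real.pi * N ^ 2 * s)))
      (by norm_num), Real.integral_rpow_mul_exp_neg_mul_Ioi (by norm_num) hr,
    Real.Gamma_one_half_eq, ← Real.sqrt_eq_rpow, one_div, Real.sqrt_inv,
    Real.sqrt_mul Real.pi_pos.le, Real.sqrt_sq hN.le]
  have := (Real.sqrt_pos.2 Real.pi_pos).ne'
  field_simp

lemma rieszKernel_neg (y : Fin d → ℝ) : rieszKernel d (-y) = -rieszKernel d y := by
  by_cases hy : y = 0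
  · simp [hy, rieszKernel]
  · ext i
    simp [rieszKernel, hy, eucNorm_neg, neg_div]

lemma measurable_rieszKernel (i : Fin d) : Measurable fun y => rieszKernel d y i := by
  have : (fun y => rieszKernel d y i) = fun y => rieszConst d * y i / eucNorm y ^ (d + 1) := by
    ext y
    by_cases hy : y = 0 <;> simp [rieszKernel, hy]
  rw [this]
  exact ((measurable_pi_apply i).const_mul _).div
    ((continuous_eucNorm (d := d)).measurable.pow_const _)

lemma rieszConst_nonneg : 0 ≤ rieszConst d := by
  unfold rieszConst
  have : 0 < Real.Gamma (((d : ℝ) + 1) / 2) := Real.Gamma_pos_of_pos (by positivity)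
  positivity

lemma abs_rieszKernel_le (y : Fin d → ℝ) (i : Fin d) :
    |rieszKernel d y i| ≤ rieszConst d / eucNorm y ^ d := by
  by_cases hy : y = 0
  · have := rieszConst_nonneg (d := d)
    simp only [rieszKernel, hy, if_true, Pi.zero_apply, abs_zero]
    exact div_nonneg this (pow_nonneg (eucNorm_nonneg _) _)
  have hN := eucNorm_pos hy
  simp only [rieszKernel, hy, if_false]
  rw [abs_div, abs_mul, abs_of_nonneg rieszConst_nonneg, abs_of_pos (pow_pos hN _), pow_succ,
    div_le_div_iff₀ (by positivity) (by positivity)]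
  have := mul_le_mul_of_nonneg_left (abs_le_eucNorm y i)
    (mul_nonneg (rieszConst_nonneg (d := d)) (pow_nonneg hN.le d))
  nlinarith

/-- A function of linear growth near the origin, integrable at infinity, is integrable
against the Riesz kernel. -/
lemma integrable_mul_rieszKernel {Q : (Fin d → ℝ) → ℂ} (hQ : Integrable Q) {C : ℝ}
    (hQC : ∀ y, ‖Q y‖ ≤ C * ‖y‖) (i : Fin d) :
    Integrable fun y => Q y * ((rieszKernel d y i : ℝ) : ℂ) := by
  have : Nonempty (Fin d) := ⟨i⟩
  have hd : 1 ≤ d := Nat.one_le_iff_ne_zero.2 fun h => (h ▸ i).elim0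
  have hc := rieszConst_nonneg (d := d)
  have hmeas := (Complex.measurable_ofReal.comp (measurable_rieszKernel i)).aestronglyMeasurable
    (μ := (volume : Measure (Fin d → ℝ)))
  let g : ℝ → ℝ := (Ioc 0 1).indicator fun r => (r ^ (d - 1))⁻¹
  have hg : Integrable fun y : Fin d → ℝ => g ‖y‖ := by
    rw [integrable_fun_norm_addHaar]
    have : IntegrableOn ((Ioc (0 : ℝ) 1).indicator fun _ => (1 : ℝ)) (Ioi 0) :=
      (IntegrableOn.integrable_indicator (by simp) measurableSet_Ioc).integrableOn
    refine this.congr_fun (fun r hr => ?_) measurableSet_Ioi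
    have hr' : r ^ (d - 1) ≠ 0 := pow_ne_zero _ (ne_of_gt hr)
    by_cases h : r ∈ Ioc (0 : ℝ) 1 <;> simp [g, h, hr']
  refine Integrable.mono' ((hQ.norm.const_mul (rieszConst d)).add
    (hg.const_mul (C * rieszConst d))) (hQ.aestronglyMeasurable.mul hmeas) (ae_of_all _ fun y => ?_)
  have hC : 0 ≤ C * ‖y‖ := (norm_nonneg _).trans (hQC y)
  rw [norm_mul, Complex.norm_real, Real.norm_eq_abs]
  simp only [Pi.add_apply]
  have hK := abs_rieszKernel_le y i
  have hle := norm_le_eucNorm y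
  rcases eq_or_ne y 0 with rfl | hy
  · simp [rieszKernel, g]
    exact mul_nonneg hc (norm_nonneg _)
  have hy' : 0 < ‖y‖ := norm_pos_iff.2 hy
  rcases le_or_gt ‖y‖ 1 with h1 | h1
  · have hg1 : g ‖y‖ = (‖y‖ ^ (d - 1))⁻¹ := by simp [g, hy, h1]
    have hK' : |rieszKernel d y i| ≤ rieszConst d / ‖y‖ ^ d :=
      hK.trans (div_le_div_of_nonneg_left hc (pow_pos hy' _) (pow_le_pow_left₀ hy'.le hle _))
    have h3 : ‖Q y‖ * |rieszKernel d y i| ≤ (C * ‖y‖) * (rieszConst d / ‖y‖ ^ d) :=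
      mul_le_mul (hQC y) hK' (abs_nonneg _) hC
    have h4 : (C * ‖y‖) * (rieszConst d / ‖y‖ ^ d) = C * rieszConst d * g ‖y‖ := by
      rw [hg1]
      obtain ⟨n, rfl⟩ : ∃ n, d = n + 1 := ⟨d - 1, by omega⟩
      simp only [Nat.add_sub_cancel, pow_succ]
      field_simp
    have := mul_nonneg hc (norm_nonneg (Q y))
    linarith
  · have hg1 : g ‖y‖ = 0 := by simp [g, not_le.2 h1]
    have hK' : |rieszKernel d y i| ≤ rieszConst d :=
      hK.trans (div_le_self hc (one_le_pow₀ (h1.le.trans hle)))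
    have := mul_le_mul_of_nonneg_left hK' (norm_nonneg (Q y))
    rw [hg1]
    linarith

end KernelIntegrals

section RieszTransform

variable {d : ℕ}

lemma abs_dotP_le (ξ y : Fin d → ℝ) : |dotP ξ y| ≤ d * (‖ξ‖ * ‖y‖) := by
  refine (Finset.abs_sum_le_sum_abs _ _).trans ?_
  refine (Finset.sum_le_card_nsmul _ _ (‖ξ‖ * ‖y‖) fun i _ => ?_).trans_eq (by simp)
  rw [abs_mul]
  exact mul_le_mul (norm_le_pi_norm ξ i) (norm_le_pi_norm y i) (abs_nonneg _) (norm_nonneg _)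

lemma norm_chr_sub_one_le (ξ y : Fin d → ℝ) : ‖chr ξ y - 1‖ ≤ 2 * Real.pi * d * (‖ξ‖ * ‖y‖) := by
  have h := Real.norm_exp_I_mul_ofReal_sub_one_le (x := 2 * Real.pi * dotP ξ y)
  rw [mul_comm Complex.I] at h
  refine h.trans ?_
  rw [Real.norm_eq_abs, abs_mul, abs_of_pos Real.two_pi_pos, mul_assoc _ (d : ℝ)]
  exact mul_le_mul_of_nonneg_left (abs_dotP_le ξ y) Real.two_pi_pos.le

lemma exists_norm_ftInv_sub_le {G : (Fin d → ℝ) → ℂ} (hG : Integrable G)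
    (hG1 : Integrable fun ξ => ‖ξ‖ * ‖G ξ‖) (x : Fin d → ℝ) :
    ∃ C, ∀ y, ‖ftInv G (x - y) - ftInv G (x + y)‖ ≤ C * ‖y‖ := by
  refine ⟨2 * (2 * Real.pi * d) * ∫ ξ, ‖ξ‖ * ‖G ξ‖, fun y => ?_⟩
  have hI : ∀ z, Integrable fun ξ => chr ξ z * G ξ := fun z =>
    integrable_chr_mul hG continuous_id continuous_const
  rw [ftInv_eq, ftInv_eq, ← integral_sub (hI _) (hI _)]
  refine (norm_integral_le_integral_norm _).trans ?_
  rw [← integral_const_mul, ← integral_mul_const]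
  refine integral_mono_of_nonneg (ae_of_all _ fun _ => norm_nonneg _)
    ((hG1.const_mul _).mul_const _) (ae_of_all _ fun ξ => ?_)
  have h : chr ξ (x - y) * G ξ - chr ξ (x + y) * G ξ =
      chr ξ x * ((chr ξ (-y) - 1) - (chr ξ y - 1)) * G ξ := by
    rw [chr_sub, chr_add]; ring
  have h1 := norm_chr_sub_one_le ξ y
  have h2 := norm_chr_sub_one_le ξ (-y)
  rw [norm_neg] at h2
  have h3 := norm_sub_le (chr ξ (-y) - 1) (chr ξ y - 1)
  simp only
  rw [h, norm_mul, norm_mul, norm_chr, one_mul]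
  calc _ ≤ (2 * (2 * Real.pi * d) * (‖ξ‖ * ‖y‖)) * ‖G ξ‖ :=
        mul_le_mul_of_nonneg_right (by linarith) (norm_nonneg _)
    _ = _ := by ring

lemma integral_mul_odd {F K : (Fin d → ℝ) → ℂ} (hK : ∀ y, K (-y) = -K y) (x : Fin d → ℝ)
    (h : Integrable fun y => F (x - y) * K y) :
    ∫ y, F (x - y) * K y = (1 / 2 : ℂ) * ∫ y, (F (x - y) - F (x + y)) * K y := by
  have h1 : (fun y => F (x + y) * K y) = fun y => -(fun y => F (x - y) * K y) (-y) := by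
    ext y; simp [hK]
  have h2 : Integrable fun y => F (x + y) * K y := by
    rw [h1]; exact h.comp_neg.neg
  simp only [sub_mul]
  rw [integral_sub h h2, h1, integral_neg, integral_neg_eq_self (fun y => F (x - y) * K y)]
  ring

lemma integrable_mul_gaussian_pi {t : ℝ} (ht : 0 < t) (i : Fin d) :
    Integrable fun y : Fin d → ℝ =>
      ((y i * Real.exp (-(Real.pi * t * eucNorm y ^ 2)) : ℝ) : ℂ) := by
  simpa [chr, dotP] using integrable_chr_mul_gaussian ht (0 : Fin d → ℝ) i

lemma integral_ftInv_mul_gaussian {G : (Fin d → ℝ) → ℂ} (hG : Integrable G) {t : ℝ} (ht : 0 < t)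
    (x : Fin d → ℝ) (i : Fin d) :
    ∫ y, ftInv G (x - y) * ((y i * Real.exp (-(Real.pi * t * eucNorm y ^ 2)) : ℝ) : ℂ) =
      ∫ ξ, chr ξ x * G ξ * (-Complex.I * ((ξ i * (t ^ (-1 - d / 2 : ℝ) *
        Real.exp (-(Real.pi * eucNorm ξ ^ 2 / t))) : ℝ) : ℂ)) := by
  have hg := integrable_mul_gaussian_pi ht i
  simp only [ftInv_eq, ← integral_mul_const, ← integral_chr_mul_gaussian ht, ← integral_const_mul]
  rw [integral_integral_swap]
  · congr 1; ext ξ; congr 1; ext y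
    rw [chr_sub]; ring
  · have h1 := hg.mul_prod hG
    refine (h1.bdd_mul (c := 1) (f := fun p => chr p.2 (x - p.1))
      (Continuous.aestronglyMeasurable (by fun_prop))
      (ae_of_all _ fun _ => (norm_chr _ _).le)).congr (ae_of_all _ fun p => ?_)
    simp only [Function.uncurry]
    ring

lemma integral_ftInv_mul_rieszKernel {G : (Fin d → ℝ) → ℂ} (hG : Integrable G)
    (hG1 : Integrable fun ξ => ‖ξ‖ * ‖G ξ‖) (hF : Integrable (ftInv G)) (x : Fin d → ℝ)
    (i : Fin d) :
    (1 / 2 : ℂ) * ∫ y, (ftInv G (x - y) - ftInv G (x + y)) * ((rieszKernel d y i : ℝ) : ℂ) =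
      ftInv (fun ξ => -Complex.I * ((ξ i / eucNorm ξ : ℝ) : ℂ) * G ξ) x := by
  have hFc : Continuous (ftInv G) := continuous_ftInv hG
  set Q : (Fin d → ℝ) → ℂ := fun y => ftInv G (x - y) - ftInv G (x + y) with hQdef
  have hQ : Integrable Q := (hF.comp_sub_left x).sub (hF.comp_add_left x)
  have hQc : Continuous Q := by fun_prop
  obtain ⟨C, hC⟩ := exists_norm_ftInv_sub_le hG hG1 x
  have hQZ := integrable_mul_rieszKernel hQ hC i
  let k : (Fin d → ℝ) → ℝ → ℝ := fun y t =>
    y i * Real.exp (-(Real.pi * t * eucNorm y ^ 2)) * t ^ (((d : ℝ) - 1) / 2)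
  have hkm : Measurable (Function.uncurry k) := by
    have := (continuous_eucNorm (d := d)).measurable
    simp only [k, Function.uncurry_def]
    fun_prop
  have h1 : Integrable (Function.uncurry fun y t => Q y * (k y t : ℂ))
      (volume.prod (volume.restrict (Ioi (0 : ℝ)))) := by
    rw [integrable_prod_iff]
    · refine ⟨ae_of_all _ fun y => ?_, ?_⟩
      · exact (integrableOn_rieszKernel_repr y i).ofReal.const_mul (Q y)
      · refine hQZ.norm.congr (ae_of_all _ fun y => ?_)
        simp only [Function.uncurry, norm_mul, Complex.norm_real, integral_const_mul]
        congr 1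
        rw [← integral_rieszKernel_repr, Real.norm_eq_abs]
        have h2 : ∀ t ∈ Ioi (0 : ℝ), ‖k y t‖ = |y i| *
            (Real.exp (-(Real.pi * t * eucNorm y ^ 2)) * t ^ (((d : ℝ) - 1) / 2)) := by
          intro t ht
          have ht' : (0 : ℝ) < t := ht
          simp only [k]
          rw [Real.norm_eq_abs, mul_assoc, abs_mul]
          congr 1
          exact abs_of_nonneg (by positivity)
        rw [setIntegral_congr_fun measurableSet_Ioi h2]
        simp only [mul_assoc, integral_const_mul]
        rw [abs_mul]
        congr 1
        refine abs_of_nonneg (setIntegral_nonneg measurableSet_Ioi fun t ht => ?_)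
        have ht' : (0 : ℝ) < t := ht
        positivity
    · exact ((hQc.measurable.comp measurable_fst).mul
        (Complex.measurable_ofReal.comp hkm)).aestronglyMeasurable
  let P : ℝ → (Fin d → ℝ) → ℂ := fun t ξ =>
    chr ξ x * G ξ * (-Complex.I * ((ξ i * heatProfile d (eucNorm ξ) t : ℝ) : ℂ))
  have h3 : ∀ t ∈ Ioi (0 : ℝ), ∫ y, Q y * (k y t : ℂ) = 2 * ∫ ξ, P t ξ := by
    intro t ht
    have ht' : (0 : ℝ) < t := ht
    have h4 := integral_mul_odd (F := ftInv G)
      (K := fun y => ((y i * Real.exp (-(Real.pi * t * eucNorm y ^ 2)) : ℝ) : ℂ))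
      (fun y => by simp [eucNorm_neg]) x
      ((integrable_mul_gaussian_pi ht' i).bdd_mul (c := ∫ ξ, ‖G ξ‖)
        (Continuous.aestronglyMeasurable (by fun_prop)) (ae_of_all _ fun y => norm_ftInv_le _))
    rw [integral_ftInv_mul_gaussian hG ht'] at h4
    have h5 : ∀ y, Q y * (k y t : ℂ) = ((t ^ (((d : ℝ) - 1) / 2) : ℝ) : ℂ) *
        ((ftInv G (x - y) - ftInv G (x + y)) *
          ((y i * Real.exp (-(Real.pi * t * eucNorm y ^ 2)) : ℝ) : ℂ)) := by
      intro y; simp only [Q, k]; push_cast; ring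
    have h6 : ∀ ξ, P t ξ = ((t ^ (((d : ℝ) - 1) / 2) : ℝ) : ℂ) * (chr ξ x * G ξ * (-Complex.I *
        ((ξ i * (t ^ (-1 - d / 2 : ℝ) * Real.exp (-(Real.pi * eucNorm ξ ^ 2 / t))) : ℝ) : ℂ))) := by
      intro ξ; simp only [P, heatProfile]; push_cast; ring
    simp only [h5, h6, integral_const_mul, h4]
    ring
  have hPm : AEStronglyMeasurable (Function.uncurry P)
      ((volume.restrict (Ioi (0 : ℝ))).prod volume) := by
    have hm := (continuous_eucNorm (d := d)).measurable
    have h8 : Measurable fun p : ℝ × (Fin d → ℝ) => p.2 i * heatProfile d (eucNorm p.2) p.1 := by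
      unfold heatProfile; fun_prop
    have h9 : AEStronglyMeasurable (fun p : ℝ × (Fin d → ℝ) => chr p.2 x)
        ((volume.restrict (Ioi (0 : ℝ))).prod volume) :=
      Continuous.aestronglyMeasurable (by fun_prop)
    exact (h9.mul hG.aestronglyMeasurable.comp_snd).mul
      ((Complex.measurable_ofReal.comp h8).const_mul _).aestronglyMeasurable
  have hPint : Integrable (Function.uncurry P) ((volume.restrict (Ioi (0 : ℝ))).prod volume) := by
    rw [integrable_prod_iff']
    · refine ⟨ae_of_all _ fun ξ => ?_, ?_⟩
      · rcases eq_or_ne ξ 0 with rfl | hξ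
        · simp [P]
        · exact (((integrableOn_heatProfile (eucNorm_pos hξ)).const_mul (ξ i)).ofReal.const_mul
            (-Complex.I)).const_mul (chr ξ x * G ξ)
      · refine Integrable.mono' hG.norm ?_ (ae_of_all _ fun ξ => ?_)
        · exact hPm.norm.prod_swap.integral_prod_right'
        · rcases eq_or_ne ξ 0 with rfl | hξ
          · simp [P]
          · have hN := eucNorm_pos hξ
            have h2 : ∀ t ∈ Ioi (0 : ℝ), ‖P t ξ‖ = ‖G ξ‖ * |ξ i| *
                heatProfile d (eucNorm ξ) t := by
              intro t ht
              simp only [P, norm_mul, norm_chr, norm_neg, Complex.norm_I, Complex.norm_real,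
                Real.norm_eq_abs, abs_of_nonneg (heatProfile_nonneg (d := d) ht)]
              ring
            simp only [Function.uncurry]
            rw [setIntegral_congr_fun measurableSet_Ioi h2, integral_const_mul,
              integral_heatProfile hN, Real.norm_eq_abs, abs_of_nonneg (by positivity), mul_assoc]
            refine mul_le_of_le_one_right (norm_nonneg _) ?_
            rw [mul_one_div]
            exact div_le_one_of_le₀ (abs_le_eucNorm ξ i) hN.le
    · exact hPm
  have h7 : ∀ y, Q y * ((rieszKernel d y i : ℝ) : ℂ) = ∫ t in Ioi (0 : ℝ), Q y * (k y t : ℂ) := by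
    intro y
    rw [integral_const_mul, ← integral_rieszKernel_repr]
    exact congrArg _ integral_ofReal.symm
  have h10 : ∫ y, (ftInv G (x - y) - ftInv G (x + y)) * ((rieszKernel d y i : ℝ) : ℂ) =
      ∫ y, ∫ t in Ioi (0 : ℝ), Q y * (k y t : ℂ) := integral_congr_ae (ae_of_all _ h7)
  rw [h10, integral_integral_swap h1, setIntegral_congr_fun measurableSet_Ioi h3, integral_const_mul,
    integral_integral_swap hPint, ← mul_assoc, ftInv_eq,
    one_div_mul_cancel two_ne_zero, one_mul]
  congr 1; ext ξ
  rcases eq_or_ne ξ 0 with rfl | hξ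
  · simp [P]
  · have h11 : ∫ t in Ioi (0 : ℝ), ((ξ i * heatProfile d (eucNorm ξ) t : ℝ) : ℂ) =
        ((∫ t in Ioi (0 : ℝ), ξ i * heatProfile d (eucNorm ξ) t : ℝ) : ℂ) := integral_ofReal
    simp only [P, integral_const_mul]
    rw [h11, integral_const_mul, integral_heatProfile (eucNorm_pos hξ)]
    push_cast
    ring

lemma tendsto_truncRiesz_ftInv {G : (Fin d → ℝ) → ℂ} (hG : Integrable G)
    (hG1 : Integrable fun ξ => ‖ξ‖ * ‖G ξ‖) (hF : Integrable (ftInv G)) (x : Fin d → ℝ) :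
    Tendsto (fun ε => truncRiesz (ftInv G) x ε) (𝓝[>] 0)
      (𝓝 fun i => ftInv (fun ξ => -Complex.I * ((ξ i / eucNorm ξ : ℝ) : ℂ) * G ξ) x) := by
  set F := ftInv G
  have hSm : ∀ ε : ℝ, MeasurableSet {y : Fin d → ℝ | ε < eucNorm y} := fun ε =>
    measurableSet_lt measurable_const continuous_eucNorm.measurable
  let K : ℝ → Fin d → (Fin d → ℝ) → ℂ := fun ε i =>
    indicator {y : Fin d → ℝ | ε < eucNorm y} fun y => ((rieszKernel d y i : ℝ) : ℂ)
  have hKm : ∀ ε i, AEStronglyMeasurable (K ε i) volume := fun ε i =>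
    ((Complex.measurable_ofReal.comp (measurable_rieszKernel i)).indicator
      (hSm ε)).aestronglyMeasurable
  have hKodd : ∀ ε i y, K ε i (-y) = -K ε i y := by
    intro ε i y
    by_cases hy : ε < eucNorm y <;> simp [K, eucNorm_neg, hy, rieszKernel_neg]
  have hint : ∀ ε > 0, ∀ i, Integrable fun y => F (x - y) * K ε i y := by
    intro ε hε i
    refine (hF.comp_sub_left x).mul_bdd (c := rieszConst d / ε ^ d) (hKm ε i)
      (ae_of_all _ fun y => ?_)
    have hc := rieszConst_nonneg (d := d)
    by_cases hy : ε < eucNorm y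
    · simp only [K, indicator, mem_ofPred_eq, hy, if_true, Complex.norm_real, Real.norm_eq_abs]
      exact (abs_rieszKernel_le y i).trans (div_le_div_of_nonneg_left hc (pow_pos hε _)
        (pow_le_pow_left₀ hε.le hy.le _))
    · simp only [K, indicator, mem_ofPred_eq, hy, if_false, norm_zero]
      positivity
  have htr : ∀ ε > 0, ∀ i, truncRiesz F x ε i =
      (1 / 2 : ℂ) * ∫ y, (F (x - y) - F (x + y)) * K ε i y := by
    intro ε hε i
    have h1 : ∀ i, (fun y => F (x - y) * K ε i y) = indicator {y : Fin d → ℝ | ε < eucNorm y}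
        fun y => F (x - y) * ((rieszKernel d y i : ℝ) : ℂ) := by
      intro i; ext y
      by_cases hy : ε < eucNorm y <;> simp [K, hy]
    rw [← integral_mul_odd (hKodd ε i) x (hint ε hε i), truncRiesz, eval_integral, h1,
      integral_indicator (hSm ε)]
    intro i
    have := hint ε hε i
    rwa [h1, integrable_indicator_iff (hSm ε)] at this
  obtain ⟨C, hC⟩ := exists_norm_ftInv_sub_le hG hG1 x
  rw [tendsto_pi_nhds]
  intro i
  rw [← integral_ftInv_mul_rieszKernel hG hG1 hF x i]
  have hQ : Integrable fun y => F (x - y) - F (x + y) :=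
    (hF.comp_sub_left x).sub (hF.comp_add_left x)
  have hQZ := integrable_mul_rieszKernel hQ hC i
  have hlim : Tendsto (fun ε => (1 / 2 : ℂ) * ∫ y, (F (x - y) - F (x + y)) * K ε i y) (𝓝[>] 0)
      (𝓝 ((1 / 2 : ℂ) * ∫ y, (F (x - y) - F (x + y)) * ((rieszKernel d y i : ℝ) : ℂ))) := by
    refine Tendsto.const_mul _ (tendsto_integral_filter_of_dominated_convergence _
      (Eventually.of_forall fun ε => hQ.aestronglyMeasurable.mul (hKm ε i))
      (Eventually.of_forall fun ε => ae_of_all _ fun y => ?_) hQZ.norm (ae_of_all _ fun y => ?_))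
    · rw [norm_mul, norm_mul]
      exact mul_le_mul_of_nonneg_left (norm_indicator_le_norm_self _ _) (norm_nonneg _)
    · rcases eq_or_ne y 0 with rfl | hy
      · simp
      · refine tendsto_const_nhds.congr' ?_
        filter_upwards [Ioo_mem_nhdsGT (eucNorm_pos hy)] with ε hε
        simp [K, hε.2]
  refine hlim.congr' ?_
  filter_upwards [self_mem_nhdsWithin] with ε hε
  exact (htr ε hε i).symm

end RieszTransform

section Inversion

variable {d : ℕ}

open scoped FourierTransform in
lemma IsSchwartz.exists_euclidean {φ : (Fin d → ℝ) → ℂ} (hφ : IsSchwartz φ) :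
    ∃ Ψ : SchwartzMap (EuclideanSpace ℝ (Fin d)) ℂ, (∀ x, φ x = Ψ (WithLp.toLp 2 x)) ∧
      (∀ ξ, ft φ ξ = 𝓕 Ψ (WithLp.toLp 2 ξ)) := by
  obtain ⟨Φ, hΦ⟩ := hφ
  refine ⟨SchwartzMap.compCLMOfContinuousLinearEquiv ℂ
    (PiLp.continuousLinearEquiv 2 ℝ fun _ : Fin d => ℝ) Φ, fun x => hΦ x, fun ξ => ?_⟩
  rw [SchwartzMap.fourier_coe, Real.fourier_eq',
    ← (PiLp.volume_preserving_toLp (Fin d)).integral_comp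
      (MeasurableEquiv.toLp 2 (Fin d → ℝ)).measurableEmbedding]
  refine integral_congr_ae (ae_of_all _ fun x => ?_)
  have h : Φ (PiLp.continuousLinearEquiv 2 ℝ (fun _ : Fin d => ℝ) (WithLp.toLp 2 x)) = Φ x := rfl
  simp [hΦ, dotP, PiLp.inner_apply, h]

lemma IsSchwartz.integrable {φ : (Fin d → ℝ) → ℂ} (hφ : IsSchwartz φ) : Integrable φ := by
  obtain ⟨Φ, hΦ⟩ := hφ
  exact Φ.integrable.congr (ae_of_all _ fun x => (hΦ x).symm)

lemma IsSchwartz.continuous {φ : (Fin d → ℝ) → ℂ} (hφ : IsSchwartz φ) : Continuous φ := by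
  obtain ⟨Φ, hΦ⟩ := hφ
  exact Φ.continuous.congr fun x => (hΦ x).symm

lemma IsSchwartz.integrable_ft {φ : (Fin d → ℝ) → ℂ} (hφ : IsSchwartz φ) :
    Integrable (ft φ) := by
  obtain ⟨Ψ, -, h⟩ := hφ.exists_euclidean
  rw [funext h]
  exact (PiLp.volume_preserving_toLp (Fin d)).integrable_comp_of_integrable
    (SchwartzMap.integrable _)

open scoped FourierTransform in
lemma IsSchwartz.ftInv_ft {φ : (Fin d → ℝ) → ℂ} (hφ : IsSchwartz φ) (x : Fin d → ℝ) :
    ftInv (ft φ) x = φ x := by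
  obtain ⟨Ψ, h, h'⟩ := hφ.exists_euclidean
  rw [h x]
  rw [← FourierTransform.fourierInv_fourier_eq (F := SchwartzMap (EuclideanSpace ℝ (Fin d)) ℂ) Ψ,
    SchwartzMap.fourierInv_coe, Real.fourierInv_eq',
    ← (PiLp.volume_preserving_toLp (Fin d)).integral_comp
      (MeasurableEquiv.toLp 2 (Fin d → ℝ)).measurableEmbedding]
  refine integral_congr_ae (ae_of_all _ fun x => ?_)
  simp [h', dotP, PiLp.inner_apply, mul_comm]

end Inversion

section Pairing

variable {d : ℕ}

lemma integral_mul_ftInv {f M : (Fin d → ℝ) → ℂ} (hf : Integrable f) (hM : Integrable M)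
    (a : ℝ) (u : Fin d → ℝ) :
    ∫ y, f y * ftInv M (u - a • y) = ∫ ξ, chr ξ u * (M ξ * ft f (a • ξ)) := by
  have hint : Integrable (fun p : (Fin d → ℝ) × (Fin d → ℝ) =>
      chr p.2 (u - a • p.1) * (f p.1 * M p.2)) := by
    refine (hf.mul_prod hM).bdd_mul (c := 1) ?_ (ae_of_all _ fun _ => (norm_chr _ _).le)
    exact (Continuous.chr (by fun_prop) (by fun_prop)).aestronglyMeasurable
  calc ∫ y, f y * ftInv M (u - a • y)
      = ∫ y, ∫ ξ, chr ξ (u - a • y) * (f y * M ξ) := by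
        refine integral_congr_ae (ae_of_all _ fun y => ?_)
        simp only [ftInv_eq, ← integral_const_mul]
        refine integral_congr_ae (ae_of_all _ fun ξ => ?_)
        ring
    _ = ∫ ξ, ∫ y, chr ξ (u - a • y) * (f y * M ξ) := integral_integral_swap hint
    _ = _ := by
        refine integral_congr_ae (ae_of_all _ fun ξ => ?_)
        simp only [ft_eq, ← integral_const_mul]
        refine integral_congr_ae (ae_of_all _ fun y => ?_)
        have h : chr (a • ξ) (-y) = chr ξ (-(a • y)) := by
          simp [chr, dotP, mul_assoc, mul_left_comm]
        simp only [chr_sub, h]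
        ring

lemma conv_eq_ftInv {μ f : (Fin d → ℝ) → ℂ} (hμ : IsSchwartz μ) (hf : Integrable f)
    (x : Fin d → ℝ) : conv μ f x = ftInv (fun ξ => ft μ ξ * ft f ξ) x := by
  have h := integral_mul_ftInv hf hμ.integrable_ft 1 x
  simp only [one_smul, hμ.ftInv_ft] at h
  rw [ftInv_eq, ← h, conv, ← integral_sub_left_eq_self _ _ x]
  simp [mul_comm]

lemma integrable_conv {μ f : (Fin d → ℝ) → ℂ} (hμ : Integrable μ) (hf : Integrable f) :
    Integrable (conv μ f) :=
  hμ.integrable_convolution (ContinuousLinearMap.mul ℝ ℂ) hf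

lemma integral_comp_vecMul_inv {b : Matrix (Fin d) (Fin d) ℝ} (hb : b.det ≠ 0)
    (g : (Fin d → ℝ) → ℂ) : ∫ ξ, g (ξ ᵥ* b⁻¹) = ((|b.det| : ℝ) : ℂ) * ∫ ξ, g ξ := by
  have hdet : (b⁻¹ᵀ).det ≠ 0 := by
    rw [det_transpose, det_nonsing_inv]; simpa using hb
  have hmap := Real.map_matrix_volume_pi_eq_smul_volume_pi hdet
  have hemb : MeasurableEmbedding (toLin' b⁻¹ᵀ) := by
    have : IsUnit b⁻¹ᵀ := (isUnit_iff_isUnit_det _).2 (isUnit_iff_ne_zero.2 hdet)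
    exact (LinearMap.continuous_of_finiteDimensional _).measurableEmbedding
      (mulVec_injective_of_isUnit this)
  have h := hemb.integral_map (μ := volume) g
  rw [hmap, integral_smul_measure] at h
  simp only [toLin'_apply, mulVec_transpose] at h
  rw [← h]
  simp [det_nonsing_inv]

lemma ft_conj_neg (φ : (Fin d → ℝ) → ℂ) (ξ : Fin d → ℝ) :
    ft (fun u => (starRingEnd ℂ) (φ (-u))) ξ = (starRingEnd ℂ) (ft φ ξ) := by
  rw [ft_eq, ft_eq, ← integral_conj, ← integral_neg_eq_self]
  refine integral_congr_ae (ae_of_all _ fun x => ?_)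
  simp [conj_chr]

lemma conj_ftInv (P : (Fin d → ℝ) → ℂ) (x : Fin d → ℝ) :
    (starRingEnd ℂ) (ftInv P x) = ftInv (fun ξ => (starRingEnd ℂ) (P ξ)) (-x) := by
  rw [ftInv_eq, ftInv_eq, ← integral_conj]
  simp [conj_chr]

/-- Analysis of an integrable function, computed on the Fourier side. -/
lemma integral_mul_conj_comp_smul_sub {f φ : (Fin d → ℝ) → ℂ} (hf : Integrable f)
    (hφ : IsSchwartz φ) (a : ℝ) (u : Fin d → ℝ) :
    ∫ x, f x * (starRingEnd ℂ) (φ (a • x - u)) =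
      ∫ η, chr η u * (ft f (a • η) * (starRingEnd ℂ) (ft φ η)) := by
  have hP : Integrable fun η => (starRingEnd ℂ) (ft φ η) :=
    (LinearIsometryEquiv.integrable_comp_iff Complex.conjLIE).2 hφ.integrable_ft
  have h := integral_mul_ftInv hf hP a u
  simp only [← neg_sub (a • _) u, ← conj_ftInv, hφ.ftInv_ft] at h
  rw [h]
  simp only [mul_comm (ft f _)]

/-- Analysis of an inverse Fourier integral, computed on the Fourier side. -/
lemma integral_ftInv_mul_conj_comp_smul_sub {H φ : (Fin d → ℝ) → ℂ} (hH : Integrable H)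
    (hφ : Integrable φ) {a : ℝ} (ha : a ≠ 0) (u : Fin d → ℝ) :
    ∫ x, ftInv H x * (starRingEnd ℂ) (φ (a • x - u)) =
      ∫ η, chr η u * (H (a • η) * (starRingEnd ℂ) (ft φ η)) := by
  have hψ : Integrable fun v => (starRingEnd ℂ) (φ (-v)) :=
    (LinearIsometryEquiv.integrable_comp_iff Complex.conjLIE).2 hφ.comp_neg
  have h := integral_mul_ftInv hψ hH a⁻¹ (a⁻¹ • u)
  simp only [ft_conj_neg] at h
  have h1 := Measure.integral_comp_smul volume (fun ξ =>
    chr ξ (a⁻¹ • u) * (H ξ * (starRingEnd ℂ) (ft φ (a⁻¹ • ξ)))) a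
  have h2 := Measure.integral_comp_smul volume (fun x =>
    ftInv H (a⁻¹ • x) * (starRingEnd ℂ) (φ (x - u))) a
  simp only [inv_smul_smul₀ ha] at h1 h2
  rw [h2]
  have h3 : ∀ η, chr (a • η) (a⁻¹ • u) = chr η u := fun η => by
    simp [chr, dotP, mul_assoc, mul_left_comm a, ha]
  simp only [h3] at h1
  rw [h1, ← h, ← integral_sub_left_eq_self _ _ u]
  congr 1
  refine integral_congr_ae (ae_of_all _ fun x => ?_)
  simp [mul_comm, smul_sub]

end Pairing

section Parseval

variable {d : ℕ}

/-- The circle `ℝ / ℤ` carries its normalized Haar measure. -/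
local instance : MeasureSpace UnitAddCircle := ⟨AddCircle.haarAddCircle⟩

local instance : Measure.IsAddHaarMeasure (volume : Measure UnitAddCircle) :=
  inferInstanceAs (Measure.IsAddHaarMeasure AddCircle.haarAddCircle)

local instance : IsProbabilityMeasure (volume : Measure UnitAddCircle) :=
  inferInstanceAs (IsProbabilityMeasure AddCircle.haarAddCircle)

open UnitAddTorus in
lemma hasSum_integral_mFourier_mul {X Y : UnitAddTorus (Fin d) → ℂ} (hX : MemLp X 2)
    (hY : MemLp Y 2) (k : Fin d → ℤ) :
    HasSum (fun l => (∫ t, mFourier (k - l) t * X t) * ∫ t, mFourier l t * Y t)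
      (∫ t, mFourier k t * (X t * Y t)) := by
  have hZ : MemLp (fun t => (starRingEnd ℂ) (mFourier k t * X t)) 2 := by
    refine MemLp.star (f := fun t => mFourier k t * X t) ?_
    refine hX.of_le ?_ (ae_of_all _ fun t => ?_)
    · exact (mFourier k).continuous.aestronglyMeasurable.mul hX.aestronglyMeasurable
    · rw [norm_mul]
      refine mul_le_of_le_one_left (norm_nonneg _) ?_
      exact ((mFourier k).norm_coe_le_norm t).trans_eq mFourier_norm
  have h := hasSum_prod_mFourierCoeff (hZ.toLp _) (hY.toLp _)
  rw [← (Equiv.neg (Fin d → ℤ)).hasSum_iff] at h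
  convert! h using 1
  · funext l
    simp only [Function.comp, Equiv.neg_apply, mFourierCoeff, neg_neg, smul_eq_mul]
    congr 1
    · rw [← integral_conj]
      refine integral_congr_ae ?_
      filter_upwards [hZ.coeFn_toLp] with t ht
      rw [ht, sub_eq_add_neg, mFourier_add, mFourier_neg]
      simp
      ring
    · refine integral_congr_ae ?_
      filter_upwards [hY.coeFn_toLp] with t ht
      rw [ht]
  · refine integral_congr_ae ?_
    filter_upwards [hZ.coeFn_toLp, hY.coeFn_toLp] with t ht ht'
    rw [ht, ht']
    simp
    ring

lemma chr_intVec (ξ : Fin d → ℝ) (l : Fin d → ℤ) :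
    chr ξ (intVec l) = UnitAddTorus.mFourier l fun i => (ξ i : UnitAddCircle) := by
  simp only [chr, UnitAddTorus.mFourier, ContinuousMap.coe_mk, fourier_coe_apply, dotP, intVec,
    ← Complex.exp_sum]
  push_cast
  simp only [Finset.mul_sum, Finset.sum_mul]
  congr 1
  refine Finset.sum_congr rfl fun i _ => ?_
  ring

lemma setIntegral_centeredCube (g : (Fin d → ℝ) → ℂ) :
    ∫ ξ in centeredCube d, g ξ =
      ∫ ξ in {ξ : Fin d → ℝ | ∀ i, ξ i ∈ Ioc (-(1 / 2) : ℝ) (-(1 / 2) + 1)}, g ξ := by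
  have h1 : {ξ : Fin d → ℝ | ∀ i, ξ i ∈ Ioc (-(1 / 2) : ℝ) (-(1 / 2) + 1)} =
      univ.pi fun _ => Ioc (-(1 / 2)) (1 / 2) := by
    ext ξ; norm_num [mem_univ_pi]
  rw [h1]
  refine setIntegral_congr_set ?_
  exact Measure.univ_pi_Ioo_ae_eq_Icc.trans Measure.univ_pi_Ioc_ae_eq_Icc.symm

/-- The function on the torus that agrees with `g` on the unit cube centered at the origin. -/
def torusLift (g : (Fin d → ℝ) → ℂ) (t : UnitAddTorus (Fin d)) : ℂ :=
  g fun i => (AddCircle.equivIoc (1 : ℝ) (-(1 / 2)) (t i) : ℝ)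

lemma torusLift_coe (g : (Fin d → ℝ) → ℂ) {ξ : Fin d → ℝ}
    (hξ : ∀ i, ξ i ∈ Ioc (-(1 / 2) : ℝ) (-(1 / 2) + 1)) :
    torusLift g (fun i => (ξ i : UnitAddCircle)) = g ξ := by
  unfold torusLift
  congr 1
  funext i
  exact AddCircle.equivIoc_coe_of_mem (hξ i)

lemma measurable_torusLift {g : (Fin d → ℝ) → ℂ} (hg : Measurable g) :
    Measurable (torusLift g) := by
  refine hg.comp (measurable_pi_lambda _ fun i => ?_)
  exact measurable_subtype_coe.comp
    ((AddCircle.measurableEquivIoc (1 : ℝ) (-(1 / 2))).measurable.comp (measurable_pi_apply i))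

lemma setIntegral_chr_mul_eq (g : (Fin d → ℝ) → ℂ) (l : Fin d → ℤ) :
    ∫ ξ in centeredCube d, chr ξ (intVec l) * g ξ =
      ∫ t, UnitAddTorus.mFourier l t * torusLift g t := by
  rw [setIntegral_centeredCube, UnitAddTorus.integral_preimage _ fun _ => -(1 / 2)]
  refine setIntegral_congr_fun ?_ fun ξ hξ => ?_
  · exact MeasurableSet.univ_pi' fun _ => measurableSet_Ioc
  · simp only [chr_intVec, torusLift_coe g hξ]

/-- Parseval's identity on the centered unit cube, in convolution form. -/
lemma hasSum_setIntegral_chr_mul {A B : (Fin d → ℝ) → ℂ} (hA : Measurable A) (hB : Measurable B)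
    {C D : ℝ} (hAC : ∀ ξ, ‖A ξ‖ ≤ C) (hBD : ∀ ξ, ‖B ξ‖ ≤ D) (k : Fin d → ℤ) :
    HasSum (fun l => (∫ ξ in centeredCube d, chr ξ (intVec (k - l)) * A ξ) *
        ∫ ξ in centeredCube d, chr ξ (intVec l) * B ξ)
      (∫ ξ in centeredCube d, chr ξ (intVec k) * (A ξ * B ξ)) := by
  simp only [setIntegral_chr_mul_eq, setIntegral_chr_mul_eq fun ξ => A ξ * B ξ]
  exact hasSum_integral_mFourier_mul
    (MemLp.of_bound (measurable_torusLift hA).aestronglyMeasurable C (ae_of_all _ fun _ => hAC _))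
    (MemLp.of_bound (measurable_torusLift hB).aestronglyMeasurable D (ae_of_all _ fun _ => hBD _)) k

end Parseval

section Multiplier

variable {d : ℕ}

open scoped FourierTransform in
lemma IsSchwartz.integrable_norm_mul_ft {φ : (Fin d → ℝ) → ℂ} (hφ : IsSchwartz φ) :
    Integrable fun ξ => ‖ξ‖ * ‖ft φ ξ‖ := by
  obtain ⟨Ψ, -, h⟩ := hφ.exists_euclidean
  have hΨ := (PiLp.volume_preserving_toLp (Fin d)).integrable_comp_of_integrable
    (SchwartzMap.integrable_pow_mul volume (𝓕 Ψ) 1)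
  refine hΨ.mono' (by have := continuous_ft hφ.integrable; fun_prop) (ae_of_all _ fun ξ => ?_)
  have hξ : ‖ξ‖ ≤ ‖WithLp.toLp 2 ξ‖ := by
    refine (norm_le_eucNorm ξ).trans_eq ?_
    simp [EuclideanSpace.norm_eq, eucNorm]
  simp only [norm_mul, norm_norm, Function.comp_apply, pow_one, h]
  gcongr

lemma abs_div_eucNorm_le_one (ξ : Fin d → ℝ) (i : Fin d) : |ξ i / eucNorm ξ| ≤ 1 := by
  rw [abs_div, abs_of_nonneg (eucNorm_nonneg ξ)]
  exact div_le_one_of_le₀ (abs_le_eucNorm ξ i) (eucNorm_nonneg ξ)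

lemma eucNorm_smul (a : ℝ) (ξ : Fin d → ℝ) : eucNorm (a • ξ) = |a| * eucNorm ξ := by
  simp only [eucNorm, Pi.smul_apply, smul_eq_mul, mul_pow, ← Finset.mul_sum]
  rw [Real.sqrt_mul (sq_nonneg a), Real.sqrt_sq_eq_abs]

/-- The symbol `-i ξᵢ / |ξ|` of the `i`-th Riesz transform. -/
def rieszSymbol (ξ : Fin d → ℝ) (i : Fin d) : ℂ := -Complex.I * ((ξ i / eucNorm ξ : ℝ) : ℂ)

lemma norm_rieszSymbol_le_one (ξ : Fin d → ℝ) (i : Fin d) : ‖rieszSymbol ξ i‖ ≤ 1 := by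
  rw [rieszSymbol, norm_mul, norm_neg, Complex.norm_I, one_mul, Complex.norm_real]
  exact abs_div_eucNorm_le_one ξ i

lemma measurable_rieszSymbol (i : Fin d) : Measurable fun ξ : Fin d → ℝ => rieszSymbol ξ i := by
  have := continuous_eucNorm (d := d)
  unfold rieszSymbol
  fun_prop

lemma rieszSymbol_smul {a : ℝ} (ha : a ≠ 0) (ξ : Fin d → ℝ) (i : Fin d) :
    rieszSymbol (a • ξ) i = (Real.sign a : ℂ) * rieszSymbol ξ i := by
  have h : (a • ξ) i / eucNorm (a • ξ) = Real.sign a * (ξ i / eucNorm ξ) := by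
    rw [eucNorm_smul, Pi.smul_apply, smul_eq_mul, mul_div_mul_comm]
    congr 1
    rcases lt_or_gt_of_ne ha with h | h
    · rw [Real.sign_of_neg h, abs_of_neg h, div_neg, div_self ha]
    · rw [Real.sign_of_pos h, abs_of_pos h, div_self ha]
  rw [rieszSymbol, h, rieszSymbol]
  push_cast
  ring

/-- The Riesz transform of `μ * f` is given by the Fourier multiplier `-i ξ / |ξ|`. -/
lemma HasRiesz.ae_eq_ftInv {μ f : (Fin d → ℝ) → ℂ} (hμ : IsSchwartz μ) (hf : Integrable f)
    {h : (Fin d → ℝ) → Fin d → ℂ} (hh : HasRiesz (conv μ f) h) :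
    ∀ᵐ x, h x = fun i => ftInv (fun ξ => rieszSymbol ξ i * (ft μ ξ * ft f ξ)) x := by
  have hft := (continuous_ft hf).aestronglyMeasurable (μ := volume)
  have hbd : ∀ᵐ ξ, ‖ft f ξ‖ ≤ ∫ x, ‖f x‖ := ae_of_all _ norm_ft_le
  have hG : Integrable fun ξ => ft μ ξ * ft f ξ := hμ.integrable_ft.mul_bdd hft hbd
  have hG1 : Integrable fun ξ => ‖ξ‖ * ‖ft μ ξ * ft f ξ‖ := by
    simp only [norm_mul, ← mul_assoc]
    exact hμ.integrable_norm_mul_ft.mul_bdd hft.norm (hbd.mono fun ξ hξ => by simpa using hξ)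
  have hconv : conv μ f = ftInv fun ξ => ft μ ξ * ft f ξ := funext (conv_eq_ftInv hμ hf)
  have hF := integrable_conv hμ.integrable hf
  rw [HasRiesz, hconv] at hh
  rw [hconv] at hF
  filter_upwards [hh] with x hx
  exact tendsto_nhds_unique hx (tendsto_truncRiesz_ftInv hG hG1 hF x)

end Multiplier

section Analysis

variable {d : ℕ} {b : Matrix (Fin d) (Fin d) ℝ}

lemma chr_vecMul_inv_mulVec (hb : b.det ≠ 0) (ξ k : Fin d → ℝ) :
    chr (ξ ᵥ* b⁻¹) (b *ᵥ k) = chr ξ k := by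
  have h : ∀ u v : Fin d → ℝ, dotP u v = u ⬝ᵥ v := fun _ _ => rfl
  have hu : IsUnit b.det := isUnit_iff_ne_zero.2 hb
  simp [chr, h, dotProduct_mulVec, vecMul_vecMul, nonsing_inv_mul b hu]

/-- The frequency profile of the analysis sequence on the centered unit cube. -/
def analysisProfile (b : Matrix (Fin d) (Fin d) ℝ) (a : ℝ) (φ f : (Fin d → ℝ) → ℂ)
    (ξ : Fin d → ℝ) : ℂ :=
  ft f (a • (ξ ᵥ* b⁻¹)) * (starRingEnd ℂ) (ft φ (ξ ᵥ* b⁻¹))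

lemma continuous_analysisProfile {φ f : (Fin d → ℝ) → ℂ} (hφ : Integrable φ) (hf : Integrable f)
    (a : ℝ) : Continuous (analysisProfile b a φ f) := by
  have h1 := continuous_ft hφ
  have h2 := continuous_ft hf
  have h3 : Continuous fun ξ : Fin d → ℝ => ξ ᵥ* b⁻¹ := continuous_id.matrix_vecMul continuous_const
  have h4 : Continuous (starRingEnd ℂ) := Complex.continuous_conj
  unfold analysisProfile
  fun_prop

lemma norm_analysisProfile_le (φ f : (Fin d → ℝ) → ℂ) (a : ℝ) (ξ : Fin d → ℝ) :
    ‖analysisProfile b a φ f ξ‖ ≤ (∫ x, ‖f x‖) * ∫ x, ‖φ x‖ := by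
  rw [analysisProfile, norm_mul, RCLike.norm_conj]
  exact mul_le_mul (norm_ft_le _) (norm_ft_le _) (norm_nonneg _)
    (integral_nonneg fun _ => norm_nonneg _)

lemma analysisProfile_eq_zero (hb : b.det ≠ 0) {φ : (Fin d → ℝ) → ℂ}
    (hφ : Function.support (ft φ) ⊆ {ξ : Fin d → ℝ | ξ ᵥ* b ∈ centeredCube d})
    (f : (Fin d → ℝ) → ℂ) (a : ℝ) {ξ : Fin d → ℝ} (hξ : ξ ∉ centeredCube d) :
    analysisProfile b a φ f ξ = 0 := by
  have h : ft φ (ξ ᵥ* b⁻¹) = 0 := by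
    by_contra hne
    have := hφ hne
    rw [mem_ofPred_eq, vecMul_vecMul, nonsing_inv_mul b (isUnit_iff_ne_zero.2 hb),
      vecMul_one] at this
    exact hξ this
  simp [analysisProfile, h]

lemma det_mul_integral_chr_mul_eq (hb : b.det ≠ 0) {φ : (Fin d → ℝ) → ℂ}
    (hφ : Function.support (ft φ) ⊆ {ξ : Fin d → ℝ | ξ ᵥ* b ∈ centeredCube d})
    (f m : (Fin d → ℝ) → ℂ) (a : ℝ) (k : Fin d → ℝ) :
    ((|b.det| : ℝ) : ℂ) * ∫ η, chr η (b *ᵥ k) *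
        (m η * (ft f (a • η) * (starRingEnd ℂ) (ft φ η))) =
      ∫ ξ in centeredCube d, chr ξ k * (m (ξ ᵥ* b⁻¹) * analysisProfile b a φ f ξ) := by
  rw [← integral_comp_vecMul_inv hb, setIntegral_eq_integral_of_forall_compl_eq_zero]
  · simp only [chr_vecMul_inv_mulVec hb, analysisProfile]
  · intro ξ hξ
    rw [analysisProfile_eq_zero hb hφ f a hξ]
    simp

end Analysis

lemma TjH_eq_setIntegral {d : ℕ} {b : Matrix (Fin d) (Fin d) ℝ} (hb : b.det ≠ 0) (α : ℕ → ℝ)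
    {φ f : (Fin d → ℝ) → ℂ} (hφS : IsSchwartz φ)
    (hφ : Function.support (ft φ) ⊆ {ξ : Fin d → ℝ | ξ ᵥ* b ∈ centeredCube d})
    (hf : Integrable f) (j : ℕ) (k : Fin d → ℤ) :
    TjH α b φ f j k =
      ∫ ξ in centeredCube d, chr ξ (intVec k) * analysisProfile b (α j) φ f ξ := by
  have h := det_mul_integral_chr_mul_eq hb hφ f (fun _ => 1) (α j) (intVec k)
  simp only [one_mul] at h
  rw [TjH, integral_mul_conj_comp_smul_sub hf hφS, h]

section Kernel

variable {d : ℕ} {b : Matrix (Fin d) (Fin d) ℝ} {ν : (Fin d → ℝ) → ℝ}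

lemma zetaFn_apply (ξ : Fin d → ℝ) (i : Fin d) :
    zetaFn b ν ξ i = rieszSymbol (ξ ᵥ* b⁻¹) i * ((ν ξ : ℝ) : ℂ) := rfl

lemma measurable_zetaFn (hν : IsCutoff d ν) (i : Fin d) : Measurable fun ξ => zetaFn b ν ξ i := by
  have h1 : Continuous fun ξ : Fin d → ℝ => ξ ᵥ* b⁻¹ := continuous_id.matrix_vecMul continuous_const
  have h2 := hν.smooth.continuous
  simp only [zetaFn_apply]
  exact ((measurable_rieszSymbol i).comp h1.measurable).mul
    (Complex.continuous_ofReal.comp h2).measurable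

lemma IsCutoff.exists_abs_le (hν : IsCutoff d ν) : ∃ C, ∀ ξ, |ν ξ| ≤ C := by
  refine hν.smooth.continuous.bounded_above_of_compact_support ?_
  refine Metric.isCompact_of_isClosed_isBounded (isClosed_tsupport ν) ?_
  exact (Bornology.IsBounded.pi fun _ => Metric.isBounded_Ioo _ _).subset hν.supp

lemma exists_norm_zetaFn_le (hν : IsCutoff d ν) : ∃ C, ∀ ξ i, ‖zetaFn b ν ξ i‖ ≤ C := by
  obtain ⟨C, hC⟩ := hν.exists_abs_le
  refine ⟨C, fun ξ i => ?_⟩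
  rw [zetaFn_apply, norm_mul, Complex.norm_real]
  exact (mul_le_of_le_one_left (norm_nonneg _) (norm_rieszSymbol_le_one _ i)).trans (hC ξ)

lemma zKernel_apply (hν : IsCutoff d ν) (l : Fin d → ℤ) (i : Fin d) :
    zKernel b ν l i = ∫ ξ in centeredCube d, chr ξ (intVec l) * zetaFn b ν ξ i := by
  have hvol : volume (centeredCube d) ≠ ⊤ :=
    (Bornology.IsBounded.pi fun _ => Metric.isBounded_Ioo _ _).measure_lt_top.ne
  obtain ⟨C, hC⟩ := exists_norm_zetaFn_le (b := b) hν
  refine eval_integral (μ := volume.restrict (centeredCube d))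
    (f := fun ξ => chr ξ (intVec l) • zetaFn b ν ξ) (fun i => ?_) i
  refine Measure.integrableOn_of_bounded (M := C) hvol ?_ (ae_of_all _ fun ξ => ?_)
  · have h : Continuous fun ξ : Fin d → ℝ => chr ξ (intVec l) := by fun_prop
    exact (h.measurable.mul (measurable_zetaFn hν i)).aestronglyMeasurable
  · simpa [norm_chr] using hC ξ i

end Kernel

lemma sign_mul_sign {a : ℝ} (ha : a ≠ 0) : (Real.sign a : ℂ) * Real.sign a = 1 := by
  rcases Real.sign_apply_eq_of_ne_zero a ha with h | h <;> simp [h]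

/-- Lemma: Riesz transforms commute with analysis.
Isotropic dilations `a_j = α_j I`; analyzer `φ` Schwartz with `φ̂` supported in `C₀ b⁻¹`.
Fix `j`, and let `μ_j` be the Schwartz function with `μ̂_j(ξ) = ν(ξ a_j⁻¹ b)`.  If
`f ∈ H¹` then `z * (T_j f) = sign(α_j) T_j (R(μ_j * f))`, where `R(μ_j * f)` is any
realization `h` of the principal-value Riesz transform of `μ_j * f`. -/
theorem statement12
    (d : ℕ) (b : Matrix (Fin d) (Fin d) ℝ) (hb : b.det ≠ 0)
    (α : ℕ → ℝ) (hα : ∀ j, α j ≠ 0)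
    (ν : (Fin d → ℝ) → ℝ) (hν : IsCutoff d ν)
    (φ : (Fin d → ℝ) → ℂ) (hφS : IsSchwartz φ)
    (hφsupp : Function.support (ft φ) ⊆ {ξ : Fin d → ℝ | ξ ᵥ* b ∈ centeredCube d})
    (j : ℕ)
    (μj : (Fin d → ℝ) → ℂ) (hμjS : IsSchwartz μj)
    (hμjft : ∀ ξ : Fin d → ℝ, ft μj ξ = ((ν ((α j)⁻¹ • (ξ ᵥ* b)) : ℝ) : ℂ))
    (f : (Fin d → ℝ) → ℂ) (hf : MemH1 f)
    (h : (Fin d → ℝ) → Fin d → ℂ) (hh : HasRiesz (conv μj f) h) :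
    ∀ k : Fin d → ℤ,
      dConv (fun k' => TjH α b φ f j k') (zKernel b ν) k =
        (Real.sign (α j) : ℂ) •
          fun i => ((|b.det| : ℝ) : ℂ) *
            ∫ x : Fin d → ℝ, h x i * (starRingEnd ℂ) (φ (α j • x - b *ᵥ intVec k)) := by
  intro k
  have hφ := hφS.integrable
  have hf1 := hf.1
  have hs := sign_mul_sign (hα j)
  obtain ⟨C, hC⟩ := exists_norm_zetaFn_le (b := b) hν
  have hsum : HasSum (fun l => TjH α b φ f j (k - l) • zKernel b ν l) fun i =>
      ∫ ξ in centeredCube d, chr ξ (intVec k) *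
        (analysisProfile b (α j) φ f ξ * zetaFn b ν ξ i) := by
    refine Pi.hasSum.2 fun i => ?_
    simp only [Pi.smul_apply, smul_eq_mul, TjH_eq_setIntegral hb α hφS hφsupp hf1,
      zKernel_apply hν]
    exact hasSum_setIntegral_chr_mul (continuous_analysisProfile hφ hf1 _).measurable
      (measurable_zetaFn hν i) (norm_analysisProfile_le φ f _) (fun ξ => hC ξ i) k
  rw [dConv, hsum.tsum_eq]
  funext i
  set H : (Fin d → ℝ) → ℂ := fun ξ => rieszSymbol ξ i * (ft μj ξ * ft f ξ) with hH
  have hHi : Integrable H := by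
    refine Integrable.bdd_mul (c := 1) ?_ (measurable_rieszSymbol i).aestronglyMeasurable
      (ae_of_all _ fun ξ => norm_rieszSymbol_le_one ξ i)
    exact hμjS.integrable_ft.mul_bdd (continuous_ft hf1).aestronglyMeasurable
      (ae_of_all _ norm_ft_le)
  have hR : ∫ x, h x i * (starRingEnd ℂ) (φ (α j • x - b *ᵥ intVec k)) =
      ∫ η, chr η (b *ᵥ intVec k) * ((Real.sign (α j) * (rieszSymbol η i * (ν (η ᵥ* b) : ℂ))) *
        (ft f (α j • η) * (starRingEnd ℂ) (ft φ η))) := by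
    have hae := HasRiesz.ae_eq_ftInv hμjS hf1 hh
    rw [integral_congr_ae (g := fun x => ftInv H x *
        (starRingEnd ℂ) (φ (α j • x - b *ᵥ intVec k))) (hae.mono fun x hx => by simp only [hx, hH]),
      integral_ftInv_mul_conj_comp_smul_sub hHi hφ (hα j)]
    refine integral_congr_ae (ae_of_all _ fun η => ?_)
    simp only [hH, rieszSymbol_smul (hα j), hμjft, smul_vecMul, inv_smul_smul₀ (hα j)]
    ring
  have hb' : b⁻¹ * b = 1 := nonsing_inv_mul b (isUnit_iff_ne_zero.2 hb)
  rw [Pi.smul_apply, hR, det_mul_integral_chr_mul_eq hb hφsupp f fun η =>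
    Real.sign (α j) * (rieszSymbol η i * (ν (η ᵥ* b) : ℂ)), smul_eq_mul, ← integral_const_mul]
  refine integral_congr_ae (ae_of_all _ fun ξ => ?_)
  simp only [vecMul_vecMul, hb', vecMul_one, zetaFn_apply]
  linear_combination (-(chr ξ (intVec k) * analysisProfile b (α j) φ f ξ *
    (rieszSymbol (ξ ᵥ* b⁻¹) i * (ν ξ : ℂ)))) * hs

end AffinePaper
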